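/- arXiv:1305.2566 — 6 statements merged into one kernel-verified Lean document; each statement's English description precedes it below -/
import Mathlib

section
/- For every prime n ≥ 3 there exists a graph G (namely the Latin-square construction graph) whose square G² is the complete multipartite graph K_{n*(2n−1)} with 2n−1 partite sets each of size n. -/
/-- Vertex type of the Latin-square construction graph: `Sum.inl (a, c)` encodes the
vertex `v_{a+1, c+1}` of `P`, and `Sum.inr (i, j)` encodes the vertex `w_{i+1, j+1}` of `Q`
(all indices written 0-indexed via `Fin`/`ZMod`). -/
def LSVertex (n : ℕ) : Type := (Fin n × ZMod n) ⊕ (Fin (n - 1) × ZMod n)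

/-- The Latin-square construction graph: the cliques `T_j` consist of the `P`-vertices with a
fixed second coordinate, and `w_{i,j}` is joined to `v_{k, L_i(j,k)}` for every `k`, where
`L_i(j,k) ≡ j + i(k-1) (mod n)` (all written 0-indexed, so the second coordinate of a
neighbor `v_{k, L_i(j,k)}` of `w_{i,j}` is `(j-1) + i·(k-1)` in `ZMod n`). -/
def latinGraph (n : ℕ) : SimpleGraph (LSVertex n) where
  Adj x y :=
    match x, y with
    | Sum.inl (a, c), Sum.inl (b, c') => c = c' ∧ a ≠ b
    | Sum.inl (k, c), Sum.inr (i, j) => c = j + (((i : ℕ) : ZMod n) + 1) * ((k : ℕ) : ZMod n)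
    | Sum.inr (i, j), Sum.inl (k, c) => c = j + (((i : ℕ) : ZMod n) + 1) * ((k : ℕ) : ZMod n)
    | Sum.inr _, Sum.inr _ => False
  symm := by
    constructor
    rintro (⟨a, c⟩ | ⟨i, j⟩) (⟨b, c'⟩ | ⟨i', j'⟩) h
    · exact ⟨h.1.symm, h.2.symm⟩
    · exact h
    · exact h
    · exact h
  loopless := by
    constructor
    rintro (⟨a, c⟩ | ⟨i, j⟩) h
    · exact h.2 rfl
    · exact h

/-- The set `P` of all `v`-vertices. -/
def Pall (n : ℕ) : Set (LSVertex n) := {x | ∃ a c, x = Sum.inl (a, c)}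

/-- The set `Q` of all `w`-vertices. -/
def Qall (n : ℕ) : Set (LSVertex n) := {x | ∃ i j, x = Sum.inr (i, j)}

/-- The partite set `P_{a+1} = {v_{a+1,1}, …, v_{a+1,n}}`. -/
def Pset (n : ℕ) (a : Fin n) : Set (LSVertex n) := {x | ∃ c, x = Sum.inl (a, c)}

/-- The clique `T_{c+1} = {v_{1,c+1}, …, v_{n,c+1}}`. -/
def Tset (n : ℕ) (c : ZMod n) : Set (LSVertex n) := {x | ∃ a, x = Sum.inl (a, c)}

/-- The partite set `Q_{i+1} = {w_{i+1,1}, …, w_{i+1,n}}`. -/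
def Qset (n : ℕ) (i : Fin (n - 1)) : Set (LSVertex n) := {x | ∃ j, x = Sum.inr (i, j)}

/-- The square of a graph: two distinct vertices are adjacent iff their distance in `G`
is at most 2, i.e. they are adjacent in `G` or have a common neighbor. -/
def graphSquare {V : Type*} (G : SimpleGraph V) : SimpleGraph V where
  Adj x y := x ≠ y ∧ (G.Adj x y ∨ ∃ z, G.Adj x z ∧ G.Adj z y)
  symm := by
    constructor
    rintro x y ⟨hxy, h | ⟨z, h1, h2⟩⟩
    · exact ⟨hxy.symm, Or.inl h.symm⟩
    · exact ⟨hxy.symm, Or.inr ⟨z, h2.symm, h1.symm⟩⟩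
  loopless := ⟨fun x h => h.1 rfl⟩

/-- `G` is `k`-choosable: for any assignment of a list of at least `k` colors to each
vertex, there is a proper coloring choosing each vertex's color from its list. -/
def Choosable {V : Type*} (G : SimpleGraph V) (k : ℕ) : Prop :=
  ∀ L : V → Finset ℕ, (∀ v, k ≤ (L v).card) →
    ∃ φ : V → ℕ, (∀ v, φ v ∈ L v) ∧ ∀ ⦃u w⦄, G.Adj u w → φ u ≠ φ w

/-- The list chromatic number: the least `k` such that `G` is `k`-choosable. -/
noncomputable def listChromaticNumber {V : Type*} (G : SimpleGraph V) : ℕ :=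
  sInf {k | Choosable G k}

/-- The chromatic number: the least `k` such that `G` has a proper `k`-coloring. -/
noncomputable def chromNum {V : Type*} (G : SimpleGraph V) : ℕ :=
  sInf {k | G.Colorable k}

theorem ls_fin_surj (n : ℕ) (hp : n.Prime) (x : ZMod n) : ∃ k : Fin n, ((k : ℕ) : ZMod n) = x := by
  have : NeZero n := ⟨hp.ne_zero⟩
  exact ⟨⟨x.val, ZMod.val_lt x⟩, ZMod.natCast_zmod_val x⟩

theorem ls_fin_inj (n : ℕ) {a b : ℕ} (ha : a < n) (hb : b < n)
    (h : (a : ZMod n) = (b : ZMod n)) : a = b := by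
  rw [ZMod.natCast_eq_natCast_iff] at h
  exact Nat.ModEq.eq_of_lt_of_lt h ha hb

theorem ls_slope_ne (n : ℕ) (i : Fin (n - 1)) : (((i : ℕ) : ZMod n) + 1) ≠ 0 := by
  intro h
  have hi := i.isLt
  have h2 : ((i.val + 1 : ℕ) : ZMod n) = ((0 : ℕ) : ZMod n) := by push_cast; exact h
  have := ls_fin_inj n (by omega) (by omega) h2
  omega

theorem ls_slope_surj (n : ℕ) (hp : n.Prime) (x : ZMod n) (hx : x ≠ 0) :
    ∃ i : Fin (n - 1), (((i : ℕ) : ZMod n) + 1) = x := by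
  obtain ⟨k, hk⟩ := ls_fin_surj n hp x
  have hk0 : (k : ℕ) ≠ 0 := by
    intro h
    rw [h] at hk
    exact hx (by rw [← hk]; simp)
  have := k.isLt
  refine ⟨⟨k.val - 1, by omega⟩, ?_⟩
  rw [← hk]
  have : ((k.val : ℕ) : ZMod n) = ((k.val - 1 + 1 : ℕ) : ZMod n) := by congr 1; omega
  rw [this]; push_cast; rfl

/-- The index of the partite set containing a vertex. -/
def lsPart (n : ℕ) (x : LSVertex n) : Fin n ⊕ Fin (n - 1) :=
  Sum.map Prod.fst Prod.fst x

theorem ls_PQ (n : ℕ) (hp : n.Prime) (k : Fin n) (c : ZMod n) (i : Fin (n - 1)) (j : ZMod n) :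
    (latinGraph n).Adj (Sum.inl (k, c)) (Sum.inr (i, j)) ∨
      ∃ z, (latinGraph n).Adj (Sum.inl (k, c)) z ∧ (latinGraph n).Adj z (Sum.inr (i, j)) := by
  have : Fact n.Prime := ⟨hp⟩
  have hs := ls_slope_ne n i
  obtain ⟨k', hk'⟩ := ls_fin_surj n hp ((c - j) / (((i : ℕ) : ZMod n) + 1))
  have key : c = j + (((i : ℕ) : ZMod n) + 1) * ((k' : ℕ) : ZMod n) := by
    rw [hk']; field_simp; ring
  by_cases h : k = k'
  · subst h
    exact Or.inl key
  · exact Or.inr ⟨Sum.inl (k', c), ⟨rfl, h⟩, key⟩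

theorem ls_square_adj (n : ℕ) (hp : n.Prime) (x y : LSVertex n) :
    (graphSquare (latinGraph n)).Adj x y ↔ lsPart n x ≠ lsPart n y := by
  have : Fact n.Prime := ⟨hp⟩
  constructor
  · rintro ⟨hne, h⟩ hpart
    rcases x with ⟨a, c⟩ | ⟨i, j⟩ <;> rcases y with ⟨b, d⟩ | ⟨i', j'⟩
    · obtain rfl : a = b := Sum.inl_injective hpart
      apply hne
      rcases h with h | ⟨⟨b, d⟩ | ⟨i', j'⟩, h1, h2⟩
      · exact absurd rfl h.2
      · have e : c = _ := h1.1.trans h2.1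
        rw [e]
      · have h1' : c = _ := h1
        have h2' : d = _ := h2
        rw [h1', h2']
    · exact absurd hpart Sum.inl_ne_inr
    · exact absurd hpart Sum.inr_ne_inl
    · obtain rfl : i = i' := Sum.inr_injective hpart
      apply hne
      rcases h with h | ⟨⟨b, d⟩ | ⟨i', j'⟩, h1, h2⟩
      · exact h.elim
      · have h1' : d = _ := h1
        have h2' : d = _ := h2
        have e : j = j' := add_right_cancel (h1'.symm.trans h2')
        rw [e]
      · exact h1.elim
  · intro hpart
    refine ⟨fun h => hpart (by rw [h]), ?_⟩
    rcases x with ⟨a, c⟩ | ⟨i, j⟩ <;> rcases y with ⟨b, d⟩ | ⟨i', j'⟩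
    · have hab : a ≠ b := fun h => hpart (congrArg Sum.inl h)
      by_cases hcd : c = d
      · exact Or.inl ⟨hcd, hab⟩
      · right
        have hab' : ((a : ℕ) : ZMod n) - ((b : ℕ) : ZMod n) ≠ 0 := fun h =>
          hab (Fin.ext (ls_fin_inj n a.isLt b.isLt (sub_eq_zero.mp h)))
        obtain ⟨i, hi⟩ := ls_slope_surj n hp
          ((c - d) / (((a : ℕ) : ZMod n) - ((b : ℕ) : ZMod n)))
          (div_ne_zero (sub_ne_zero.mpr hcd) hab')
        have hm : (((i : ℕ) : ZMod n) + 1) * (((a : ℕ) : ZMod n) - ((b : ℕ) : ZMod n)) = c - d := by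
          rw [hi]; exact div_mul_cancel₀ _ hab'
        refine ⟨Sum.inr (i, c - (((i : ℕ) : ZMod n) + 1) * ((a : ℕ) : ZMod n)), ?_, ?_⟩
        · show c = c - (((i : ℕ) : ZMod n) + 1) * ((a : ℕ) : ZMod n) + _
          ring
        · show d = c - (((i : ℕ) : ZMod n) + 1) * ((a : ℕ) : ZMod n) + _
          linear_combination hm
    · exact ls_PQ n hp a c i' j'
    · rcases ls_PQ n hp b d i j with h | ⟨z, h1, h2⟩
      · exact Or.inl h.symm
      · exact Or.inr ⟨z, h2.symm, h1.symm⟩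
    · have hii : i ≠ i' := fun h => hpart (congrArg Sum.inr h)
      right
      have hii' : ((i : ℕ) : ZMod n) - ((i' : ℕ) : ZMod n) ≠ 0 := fun h =>
        hii (Fin.ext (ls_fin_inj n (by have := i.isLt; omega) (by have := i'.isLt; omega)
          (sub_eq_zero.mp h)))
      obtain ⟨k, hk⟩ := ls_fin_surj n hp
        ((j' - j) / (((i : ℕ) : ZMod n) - ((i' : ℕ) : ZMod n)))
      have hm : ((k : ℕ) : ZMod n) * (((i : ℕ) : ZMod n) - ((i' : ℕ) : ZMod n)) = j' - j := by
        rw [hk]; exact div_mul_cancel₀ _ hii'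
      refine ⟨Sum.inl (k, j + (((i : ℕ) : ZMod n) + 1) * ((k : ℕ) : ZMod n)), rfl, ?_⟩
      show j + (((i : ℕ) : ZMod n) + 1) * ((k : ℕ) : ZMod n) = _
      linear_combination hm

/-- For every prime `n ≥ 3` there exists a graph `G` whose square `G²` is (isomorphic to)
the complete multipartite graph `K_{n*(2n-1)}` with `2n-1` partite sets each of size `n`. -/
theorem exists_graph_square_eq_completeMultipartite (n : ℕ) (hp : n.Prime) (hn : 3 ≤ n) :
    ∃ (V : Type) (G : SimpleGraph V),
      Nonempty (graphSquare G ≃g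
        SimpleGraph.completeMultipartiteGraph (fun _ : Fin (2 * n - 1) => Fin n)) := by
  have : NeZero n := ⟨hp.ne_zero⟩
  let e1 : Fin n ⊕ Fin (n - 1) ≃ Fin (2 * n - 1) :=
    finSumFinEquiv.trans (finCongr (by omega))
  let e : LSVertex n ≃ (Σ _ : Fin (2 * n - 1), Fin n) :=
    ((Equiv.sumProdDistrib (Fin n) (Fin (n - 1)) (ZMod n)).symm.trans
      (Equiv.prodCongr e1 (ZMod.finEquiv n).symm.toEquiv)).trans
      (Equiv.sigmaEquivProd _ _).symm
  have he : ∀ x, (e x).1 = e1 (lsPart n x) := by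
    rintro (⟨a, c⟩ | ⟨i, j⟩) <;> rfl
  refine ⟨LSVertex n, latinGraph n, ⟨⟨e, ?_⟩⟩⟩
  intro x y
  rw [ls_square_adj n hp]
  show (e x).1 ≠ (e y).1 ↔ _
  rw [he, he, e1.injective.ne_iff]
end

section
/- There exists a graph G such that χ_ℓ(G²) > χ(G²); that is, the List Square Coloring Conjecture (which asserts χ_ℓ(G²) = χ(G²) for every graph G) is false. -/
/-- Directed version of the adjacency of the Latin-square graph for `n = 3`: the first
coordinate is the part (parts `0,1,2` form `P`, parts `3,4` form `Q`). -/
def sqAdj (x y : Fin 5 × Fin 3) : Bool :=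
  if x.1.val < 3 then
    if y.1.val < 3 then x.2 == y.2 && x.1 != y.1
    else x.2.val == (y.2.val + (y.1.val - 2) * x.1.val) % 3
  else false

/-- The Latin-square graph for `n = 3` on `Fin 5 × Fin 3`. -/
def sqGraph : SimpleGraph (Fin 5 × Fin 3) where
  Adj x y := (sqAdj x y || sqAdj y x) = true
  symm := ⟨fun x y h => by rw [Bool.or_comm]; exact h⟩
  loopless := ⟨by decide⟩

instance : DecidableRel sqGraph.Adj := fun x y =>
  inferInstanceAs (Decidable ((sqAdj x y || sqAdj y x) = true))

/-- The square is complete multipartite with five parts of size three. -/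
lemma sq_adj_iff : ∀ x y : Fin 5 × Fin 3, (graphSquare sqGraph).Adj x y ↔ x.1 ≠ y.1 := by
  have h : ∀ x y : Fin 5 × Fin 3,
      (x ≠ y ∧ (sqGraph.Adj x y ∨ ∃ z, sqGraph.Adj x z ∧ sqGraph.Adj z y)) ↔ x.1 ≠ y.1 := by
    set_option maxRecDepth 100000 in
    decide +kernel
  exact h

lemma not_choosable_sq {k : ℕ} (hk : k ≤ 5) : ¬ Choosable (graphSquare sqGraph) k := by
  intro h
  obtain ⟨φ, hmem, hadj⟩ := h (fun v => (Finset.range 9).filter (fun c => c % 3 ≠ v.2.val)) (by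
    rintro ⟨a, c⟩
    refine hk.trans ?_
    revert a c
    decide)
  simp only [Finset.mem_filter, Finset.mem_range] at hmem
  have hex : ∀ p : Fin 5, ∃ j : Fin 3, φ (p, 0) ≠ φ (p, j) := by
    intro p
    by_contra! hc
    have h0 := (hmem (p, 0)).2
    have h1 := (hmem (p, 1)).2
    have h2 := (hmem (p, 2)).2
    rw [← hc 1] at h1
    rw [← hc 2] at h2
    simp at h0 h1 h2
    omega
  choose j hj using hex
  let f : Fin 5 × Bool → Fin 9 := fun q =>
    ⟨φ (q.1, if q.2 then j q.1 else 0), (hmem _).1⟩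
  have hf : Function.Injective f := by
    rintro ⟨p, b⟩ ⟨q, b'⟩ hpq
    have e : φ (p, if b then j p else 0) = φ (q, if b' then j q else 0) := congrArg Fin.val hpq
    have hp : p = q := by
      by_contra hne
      exact hadj ((sq_adj_iff _ _).2 hne) e
    subst hp
    have hp := hj p
    cases b <;> cases b'
    · rfl
    · exact absurd e hp
    · exact absurd e.symm hp
    · rfl
  have := Fintype.card_le_of_injective f hf
  simp at this

/-- Every finite graph is `|V|`-choosable, by Hall's theorem. -/
lemma choosable_card {V : Type*} [Fintype V] (G : SimpleGraph V) :
    Choosable G (Fintype.card V) := by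
  classical
  intro L hL
  obtain ⟨φ, hinj, hφ⟩ := (Finset.all_card_le_biUnion_card_iff_exists_injective L).1 (by
    intro s
    rcases s.eq_empty_or_nonempty with rfl | ⟨v, hv⟩
    · simp
    · exact (s.card_le_univ.trans (hL v)).trans
        (Finset.card_le_card (Finset.subset_biUnion_of_mem L hv)))
  exact ⟨φ, hφ, fun u w huw e => huw.ne (hinj e)⟩

/-- There exists a graph `G` with `χ_ℓ(G²) > χ(G²)`: the List Square Coloring Conjecture
is false. -/
theorem exists_graph_square_not_chromatic_choosable :
    ∃ (V : Type) (_ : Fintype V) (G : SimpleGraph V),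
      chromNum (graphSquare G) < listChromaticNumber (graphSquare G) := by
  refine ⟨Fin 5 × Fin 3, inferInstance, sqGraph, ?_⟩
  have h1 : chromNum (graphSquare sqGraph) ≤ 5 :=
    Nat.sInf_le ⟨SimpleGraph.Coloring.mk (fun v => v.1) (fun {u w} h => (sq_adj_iff u w).1 h)⟩
  have h2 : Choosable (graphSquare sqGraph) (listChromaticNumber (graphSquare sqGraph)) :=
    Nat.sInf_mem (s := {k | Choosable (graphSquare sqGraph) k}) ⟨_, choosable_card _⟩
  by_contra hlt
  exact not_choosable_sq ((not_lt.1 hlt).trans h1) h2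
end

section
/- In the Latin-square construction graph G, any two distinct vertices x, y ∈ P have at most one common neighbor lying in Q: |N_G(x) ∩ N_G(y) ∩ Q| ≤ 1. -/
/-- In the Latin-square construction graph, any two distinct vertices `x, y ∈ P` have at
most one common neighbor lying in `Q`: `|N_G(x) ∩ N_G(y) ∩ Q| ≤ 1`. -/
theorem common_neighbors_of_P_in_Q (n : ℕ) (hp : n.Prime) (hn : 3 ≤ n)
    (x y : LSVertex n) (hx : x ∈ Pall n) (hy : y ∈ Pall n) (hxy : x ≠ y) :
    ((latinGraph n).neighborSet x ∩ (latinGraph n).neighborSet y ∩ Qall n).ncard ≤ 1 := by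
  haveI : Fact n.Prime := ⟨hp⟩
  obtain ⟨a, c, rfl⟩ := hx
  obtain ⟨b, d, rfl⟩ := hy
  have key : ((latinGraph n).neighborSet (Sum.inl (a, c)) ∩
      (latinGraph n).neighborSet (Sum.inl (b, d)) ∩ Qall n).Subsingleton := by
    rintro z ⟨⟨h1, h2⟩, i, j, rfl⟩ w ⟨⟨h3, h4⟩, i', j', rfl⟩
    change c = j + (((i : ℕ) : ZMod n) + 1) * ((a : ℕ) : ZMod n) at h1
    change d = j + (((i : ℕ) : ZMod n) + 1) * ((b : ℕ) : ZMod n) at h2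
    change c = j' + (((i' : ℕ) : ZMod n) + 1) * ((a : ℕ) : ZMod n) at h3
    change d = j' + (((i' : ℕ) : ZMod n) + 1) * ((b : ℕ) : ZMod n) at h4
    have cast_inj : ∀ p q : ℕ, p < n → q < n → (p : ZMod n) = (q : ZMod n) → p = q := by
      intro p q hp' hq' h
      rw [ZMod.natCast_eq_natCast_iff'] at h
      rwa [Nat.mod_eq_of_lt hp', Nat.mod_eq_of_lt hq'] at h
    have hab : ((a : ℕ) : ZMod n) - ((b : ℕ) : ZMod n) ≠ 0 := by
      intro h
      have hab : a = b := Fin.ext (cast_inj _ _ a.2 b.2 (sub_eq_zero.mp h))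
      subst hab
      exact hxy (by rw [h1, h2])
    have hprod : (((i : ℕ) : ZMod n) - ((i' : ℕ) : ZMod n)) *
        (((a : ℕ) : ZMod n) - ((b : ℕ) : ZMod n)) = 0 := by
      linear_combination h2 - h1 + h3 - h4
    have hi := sub_eq_zero.mp ((mul_eq_zero.mp hprod).resolve_right hab)
    have hii : i = i' := Fin.ext (cast_inj _ _ (by omega) (by omega) hi)
    subst hii
    have hj : j = j' := by linear_combination h3 - h1
    rw [hj]
  exact (Set.ncard_le_one key.finite).mpr fun p hp' q hq' => key hp' hq'
end

section
/- In the Latin-square construction graph G, the subgraph of G² induced by P is the complete multipartite graph K_{n*n} with partite sets P_1, P_2, …, P_n; that is, two distinct vertices of P are adjacent in G² if and only if they lie in different sets P_i. -/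
/-- In the Latin-square construction graph `G`, the subgraph of `G²` induced by `P` is the
complete multipartite graph `K_{n*n}` with partite sets `P_1, …, P_n`: two distinct
vertices of `P` are adjacent in `G²` iff they lie in different sets `P_i`. -/
theorem square_on_P_complete_multipartite (n : ℕ) (hp : n.Prime) (hn : 3 ≤ n)
    (x y : LSVertex n) (hx : x ∈ Pall n) (hy : y ∈ Pall n) (hxy : x ≠ y) :
    (graphSquare (latinGraph n)).Adj x y ↔
      ¬ ∃ a : Fin n, x ∈ Pset n a ∧ y ∈ Pset n a := by
  have : Fact n.Prime := ⟨hp⟩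
  obtain ⟨a, c, rfl⟩ := hx
  obtain ⟨b, d, rfl⟩ := hy
  constructor
  · rintro ⟨-, h⟩ ⟨e, ⟨c1, h1⟩, ⟨d1, h2⟩⟩
    have h1' := Sum.inl.inj h1
    have h2' := Sum.inl.inj h2
    obtain ⟨rfl, rfl⟩ := Prod.mk.inj h1'
    obtain ⟨rfl, rfl⟩ := Prod.mk.inj h2'
    rcases h with h | ⟨⟨k, f⟩ | ⟨i, j⟩, h3, h4⟩
    · exact h.2 rfl
    · have h5 : c = f := h3.1
      have h6 : f = d := h4.1
      subst h5
      subst h6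
      exact hxy rfl
    · have h5 : c = j + (((i : ℕ) : ZMod n) + 1) * ((b : ℕ) : ZMod n) := h3
      have h6 : d = j + (((i : ℕ) : ZMod n) + 1) * ((b : ℕ) : ZMod n) := h4
      have h7 : c = d := h5.trans h6.symm
      subst h7
      exact hxy rfl
  · intro h
    have hab : a ≠ b := by
      rintro rfl
      exact h ⟨a, ⟨c, rfl⟩, ⟨d, rfl⟩⟩
    refine ⟨hxy, ?_⟩
    by_cases hcd : c = d
    · exact Or.inl ⟨hcd, hab⟩
    · right
      have hne : ((a : ℕ) : ZMod n) - ((b : ℕ) : ZMod n) ≠ 0 := by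
        intro h0
        have h1 := (ZMod.natCast_eq_natCast_iff' _ _ _).1 (sub_eq_zero.1 h0)
        rw [Nat.mod_eq_of_lt a.2, Nat.mod_eq_of_lt b.2] at h1
        exact hab (Fin.ext h1)
      obtain ⟨m, hm⟩ : ∃ m : ZMod n, m = (c - d) / (((a : ℕ) : ZMod n) - ((b : ℕ) : ZMod n)) :=
        ⟨_, rfl⟩
      have hm0 : m ≠ 0 := by
        rw [hm]
        exact div_ne_zero (sub_ne_zero.2 hcd) hne
      have hmul : m * (((a : ℕ) : ZMod n) - ((b : ℕ) : ZMod n)) = c - d := by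
        rw [hm]
        exact div_mul_cancel₀ _ hne
      have hpos : 0 < m.val := Nat.pos_of_ne_zero (fun h0 => hm0 ((ZMod.val_eq_zero m).1 h0))
      have hlt : m.val < n := ZMod.val_lt m
      have hi : m.val - 1 < n - 1 := by omega
      have hcast : (((m.val - 1 : ℕ) : ZMod n) + 1) = m := by
        have h2 : ((m.val - 1 + 1 : ℕ) : ZMod n) = m := by
          rw [Nat.sub_add_cancel hpos]
          exact ZMod.natCast_zmod_val m
        exact (Nat.cast_succ _).symm.trans h2
      refine ⟨Sum.inr (⟨m.val - 1, hi⟩, c - m * ((a : ℕ) : ZMod n)), ?_, ?_⟩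
      · change c = c - m * ((a : ℕ) : ZMod n) +
          (((m.val - 1 : ℕ) : ZMod n) + 1) * ((a : ℕ) : ZMod n)
        rw [hcast]
        ring
      · change d = c - m * ((a : ℕ) : ZMod n) +
          (((m.val - 1 : ℕ) : ZMod n) + 1) * ((b : ℕ) : ZMod n)
        rw [hcast]
        linear_combination hmul
end

section
/- In the Latin-square construction graph G, the subgraph of G² induced by Q is the complete multipartite graph K_{n*(n−1)} with partite sets Q_1, …, Q_{n−1}; that is, two distinct vertices of Q are adjacent in G² if and only if they lie in different sets Q_i. -/
/-- In the Latin-square construction graph `G`, the subgraph of `G²` induced by `Q` is the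
complete multipartite graph `K_{n*(n-1)}` with partite sets `Q_1, …, Q_{n-1}`: two
distinct vertices of `Q` are adjacent in `G²` iff they lie in different sets `Q_i`. -/
theorem square_on_Q_complete_multipartite (n : ℕ) (hp : n.Prime) (hn : 3 ≤ n)
    (x y : LSVertex n) (hx : x ∈ Qall n) (hy : y ∈ Qall n) (hxy : x ≠ y) :
    (graphSquare (latinGraph n)).Adj x y ↔
      ¬ ∃ i : Fin (n - 1), x ∈ Qset n i ∧ y ∈ Qset n i := by
  haveI : Fact n.Prime := ⟨hp⟩
  obtain ⟨i, j, rfl⟩ := hx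
  obtain ⟨i', j', rfl⟩ := hy
  constructor
  · rintro ⟨-, h | ⟨z, h1, h2⟩⟩ ⟨l, ⟨a, ha⟩, ⟨b, hb⟩⟩
    · exact h
    · have ha' := Sum.inr.inj ha
      have hb' := Sum.inr.inj hb
      have e1 : i = l := congrArg Prod.fst ha'
      have e2 : i' = l := congrArg Prod.fst hb'
      subst e1
      subst e2
      rcases z with ⟨k, c⟩ | ⟨u, v⟩
      · have h1' : c = j + (((i' : ℕ) : ZMod n) + 1) * ((k : ℕ) : ZMod n) := h1
        have h2' : c = j' + (((i' : ℕ) : ZMod n) + 1) * ((k : ℕ) : ZMod n) := h2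
        have e : j = j' := add_right_cancel (h1'.symm.trans h2')
        subst e
        exact hxy rfl
      · exact h1
  · intro h
    have hi : i ≠ i' := by
      rintro rfl
      exact h ⟨i, ⟨j, rfl⟩, ⟨j', rfl⟩⟩
    have hne : ((i : ℕ) : ZMod n) - ((i' : ℕ) : ZMod n) ≠ 0 := by
      intro h0
      have h1 := (ZMod.natCast_eq_natCast_iff' _ _ _).1 (sub_eq_zero.1 h0)
      have l1 := i.2
      have l2 := i'.2
      rw [Nat.mod_eq_of_lt (by omega), Nat.mod_eq_of_lt (by omega)] at h1
      exact hi (Fin.ext h1)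
    let t : ZMod n := (j' - j) / (((i : ℕ) : ZMod n) - ((i' : ℕ) : ZMod n))
    have ht : t * (((i : ℕ) : ZMod n) - ((i' : ℕ) : ZMod n)) = j' - j := div_mul_cancel₀ _ hne
    have hv : ((t.val : ℕ) : ZMod n) = t := ZMod.natCast_zmod_val t
    refine ⟨hxy, Or.inr ⟨Sum.inl (⟨t.val, ZMod.val_lt t⟩,
      j + (((i : ℕ) : ZMod n) + 1) * ((t.val : ℕ) : ZMod n)), rfl, ?_⟩⟩
    change j + (((i : ℕ) : ZMod n) + 1) * ((t.val : ℕ) : ZMod n)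
      = j' + (((i' : ℕ) : ZMod n) + 1) * ((t.val : ℕ) : ZMod n)
    rw [hv]
    linear_combination ht
end

section
/- For every prime n ≥ 3, if G is the Latin-square construction graph, then the chromatic number of its square is χ(G²) = 2n − 1. -/
/-- For every prime `n ≥ 3`, the square of the Latin-square construction graph has
chromatic number `2n - 1`. -/
theorem chromNum_square_latinGraph (n : ℕ) (hp : n.Prime) (hn : 3 ≤ n) :
    chromNum (graphSquare (latinGraph n)) = 2 * n - 1 := by
  have hpos : 0 < n := by omega
  have hup : (graphSquare (latinGraph n)).Colorable (2 * n - 1) := by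
    let col : LSVertex n → Fin n ⊕ Fin (n - 1) := fun x =>
      match x with
      | Sum.inl (a, _) => Sum.inl a
      | Sum.inr (i, _) => Sum.inr i
    have hcol : ∀ {x y}, (graphSquare (latinGraph n)).Adj x y → col x ≠ col y := by
      rintro (⟨a, c⟩ | ⟨i, j⟩) (⟨b, c'⟩ | ⟨i', j'⟩) ⟨hne, h⟩ heq
      · obtain rfl : a = b := Sum.inl.inj heq
        apply hne
        suffices hc : c = c' by rw [hc]
        rcases h with h | ⟨⟨d, e⟩ | ⟨i, j⟩, h1, h2⟩
        · exact h.1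
        · exact h1.1.trans h2.1
        · exact Eq.trans h1 (Eq.symm h2)
      · exact absurd heq (by simp [col])
      · exact absurd heq (by simp [col])
      · obtain rfl : i = i' := Sum.inr.inj heq
        apply hne
        suffices hc : j = j' by rw [hc]
        rcases h with h | ⟨⟨d, e⟩ | ⟨i, j⟩, h1, h2⟩
        · exact h.elim
        · exact add_right_cancel (Eq.trans (Eq.symm h1) h2)
        · exact h1.elim
    have h := (SimpleGraph.Coloring.mk col hcol).colorable
    have hc : Fintype.card (Fin n ⊕ Fin (n - 1)) = 2 * n - 1 := by
      simp; omega
    rwa [hc] at h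
  apply le_antisymm
  · exact Nat.sInf_le hup
  · refine le_csInf ⟨_, hup⟩ ?_
    rintro k ⟨C⟩
    let f : Fin n ⊕ Fin (n - 1) → LSVertex n := fun x =>
      match x with
      | Sum.inl a => Sum.inl (a, 0)
      | Sum.inr i => Sum.inr (i, 0)
    have hw : ∀ i : Fin (n - 1),
        (latinGraph n).Adj (Sum.inl (⟨0, hpos⟩, 0)) (Sum.inr (i, 0)) := by
      intro i
      simp [latinGraph]
    have hv : ∀ a b : Fin n, a ≠ b →
        (latinGraph n).Adj (Sum.inl (a, 0)) (Sum.inl (b, 0)) := by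
      intro a b hab
      exact ⟨rfl, hab⟩
    have hvw : ∀ (a : Fin n) (i : Fin (n - 1)),
        (graphSquare (latinGraph n)).Adj (Sum.inl (a, 0)) (Sum.inr (i, 0)) := by
      intro a i
      refine ⟨Sum.inl_ne_inr, ?_⟩
      by_cases ha : a = ⟨0, hpos⟩
      · subst ha
        exact Or.inl (hw i)
      · exact Or.inr ⟨_, hv _ _ ha, hw i⟩
    have hf : ∀ x y, x ≠ y → (graphSquare (latinGraph n)).Adj (f x) (f y) := by
      rintro (a | i) (b | i') hne
      · have hab : a ≠ b := fun h => hne (by rw [h])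
        exact ⟨(hv a b hab).ne, Or.inl (hv a b hab)⟩
      · exact hvw a i'
      · exact (hvw b i).symm
      · refine ⟨fun h => hne ?_, Or.inr ⟨_, (hw i).symm, hw i'⟩⟩
        have h2 := Sum.inr.inj h
        rw [(Prod.mk.inj h2).1]
    have hinj : Function.Injective (fun x => C (f x)) := by
      intro x y hxy
      by_contra hne
      exact C.valid (hf x y hne) hxy
    have hc := Fintype.card_le_of_injective _ hinj
    simp at hc
    omega
end
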